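/- arXiv:1909.04299 — 3 statements merged into one kernel-verified Lean document; each statement's English description precedes it below -/
import Mathlib

section
/- Let T ≥ 1 be an integer and define g(k,T) := θ_{k+T} − θ_k − ε Σ_{j=k}^{k+T−1} f(θ_k, x_j). Then for every k ∈ ℕ and every T ≥ 1 one has ‖g(k,T)‖ ≤ ε² L² T² (1+εL)^{T−2} (‖θ_k‖ + 1), where (1+εL)^{T−2} denotes the real power (equal to (1+εL)^{−1} when T = 1). -/
open Finset

/-- A Bernoulli-type upper bound: the first-order remainder of `(1 + a) ^ n`. -/
lemma one_add_pow_succ_sub_one_le {a : ℝ} (ha : 0 ≤ a) (n : ℕ) :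
    (1 + a) ^ (n + 1) - 1 ≤ (n + 1) * a * (1 + a) ^ n := by
  induction n with
  | zero => simp
  | succ n ih =>
    have h1 : (1 : ℝ) ≤ (1 + a) ^ (n + 1) := one_le_pow₀ (by linarith)
    have h2 := mul_le_mul_of_nonneg_right ih (by linarith : 0 ≤ 1 + a)
    have h3 := mul_le_mul_of_nonneg_left h1 ha
    push_cast
    rw [pow_succ _ (n + 1)]
    have h4 : (n + 1) * a * (1 + a) ^ n * (1 + a) = (n + 1) * a * (1 + a) ^ (n + 1) := by ring
    linarith

/-- The second-order remainder of `(1 + a) ^ n`. -/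
lemma one_add_pow_sub_linear_le {a : ℝ} (ha : 0 ≤ a) (n : ℕ) :
    (1 + a) ^ (n + 2) - 1 - (n + 2) * a ≤ a ^ 2 * (n + 2) ^ 2 * (1 + a) ^ n := by
  induction n with
  | zero =>
    norm_num
    nlinarith [sq_nonneg a]
  | succ n ih =>
    have h1 := mul_le_mul_of_nonneg_left (one_add_pow_succ_sub_one_le ha (n + 1)) ha
    have h2 : (1 + a) ^ n ≤ (1 + a) ^ (n + 1) := pow_le_pow_right₀ (by linarith) (by omega)
    have h3 : a ^ 2 * ((n : ℝ) + 2) ^ 2 * (1 + a) ^ n ≤ a ^ 2 * (n + 2) ^ 2 * (1 + a) ^ (n + 1) :=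
      mul_le_mul_of_nonneg_left h2 (by positivity)
    have h4 : 0 ≤ a ^ 2 * ((n : ℝ) + 3) * (1 + a) ^ (n + 1) := by positivity
    push_cast at h1 ⊢
    rw [pow_succ _ (n + 2)]
    have h5 : a ^ 2 * ((n : ℝ) + 1 + 2) ^ 2 * (1 + a) ^ (n + 1) =
        a ^ 2 * (n + 2) ^ 2 * (1 + a) ^ (n + 1) + a * ((n + 1 + 1) * a * (1 + a) ^ (n + 1)) +
          a ^ 2 * (n + 3) * (1 + a) ^ (n + 1) := by ring
    linarith

section Iterates

variable {E 𝒳 : Type*} [NormedAddCommGroup E] [NormedSpace ℝ E] {L ε : ℝ} {f : E → 𝒳 → E}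
  {x : ℕ → 𝒳} {θ : ℕ → E}

/-- Growth of the displacement of an iteration whose update field has linear growth. -/
lemma norm_iterate_sub_le (hL : 0 ≤ L) (hε : 0 ≤ ε) (hbnd : ∀ θ x, ‖f θ x‖ ≤ L * (‖θ‖ + 1))
    (hiter : ∀ j, θ (j + 1) = θ j + ε • f (θ j) (x j)) (k n : ℕ) :
    ‖θ (k + n) - θ k‖ ≤ ((1 + ε * L) ^ n - 1) * (‖θ k‖ + 1) := by
  induction n with
  | zero => simp
  | succ n ih =>
    have htri : ‖θ (k + n)‖ ≤ ‖θ (k + n) - θ k‖ + ‖θ k‖ := norm_le_norm_sub_add _ _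
    calc ‖θ (k + (n + 1)) - θ k‖
        = ‖(θ (k + n) - θ k) + ε • f (θ (k + n)) (x (k + n))‖ := by
          rw [← add_assoc, hiter, add_sub_right_comm]
      _ ≤ ‖θ (k + n) - θ k‖ + ε * ‖f (θ (k + n)) (x (k + n))‖ :=
          (norm_add_le _ _).trans_eq (by rw [norm_smul, Real.norm_of_nonneg hε])
      _ ≤ ‖θ (k + n) - θ k‖ + ε * (L * ((‖θ (k + n) - θ k‖ + ‖θ k‖) + 1)) := by
          gcongr
          exact (hbnd _ _).trans (by gcongr)
      _ = (1 + ε * L) * ‖θ (k + n) - θ k‖ + ε * L * (‖θ k‖ + 1) := by ring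
      _ ≤ (1 + ε * L) * (((1 + ε * L) ^ n - 1) * (‖θ k‖ + 1)) + ε * L * (‖θ k‖ + 1) := by
          gcongr
      _ = ((1 + ε * L) ^ (n + 1) - 1) * (‖θ k‖ + 1) := by ring

/-- The error of freezing the update field at `θ k` for `n` steps. -/
lemma norm_iterate_sub_frozen_le (hL : 0 ≤ L) (hε : 0 ≤ ε)
    (hlip : ∀ θ θ' x, ‖f θ x - f θ' x‖ ≤ L * ‖θ - θ'‖)
    (hbnd : ∀ θ x, ‖f θ x‖ ≤ L * (‖θ‖ + 1))
    (hiter : ∀ j, θ (j + 1) = θ j + ε • f (θ j) (x j)) (k n : ℕ) :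
    ‖θ (k + n) - θ k - ε • ∑ j ∈ Finset.Ico k (k + n), f (θ k) (x j)‖ ≤
      ((1 + ε * L) ^ n - 1 - n * (ε * L)) * (‖θ k‖ + 1) := by
  induction n with
  | zero => simp
  | succ n ih =>
    calc ‖θ (k + (n + 1)) - θ k - ε • ∑ j ∈ Finset.Ico k (k + (n + 1)), f (θ k) (x j)‖
        = ‖(θ (k + n) - θ k - ε • ∑ j ∈ Finset.Ico k (k + n), f (θ k) (x j)) +
            ε • (f (θ (k + n)) (x (k + n)) - f (θ k) (x (k + n)))‖ := by
          rw [← add_assoc, hiter, Finset.sum_Ico_succ_top (by omega), smul_add, smul_sub]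
          congr 1
          abel
      _ ≤ ‖θ (k + n) - θ k - ε • ∑ j ∈ Finset.Ico k (k + n), f (θ k) (x j)‖ +
            ε * ‖f (θ (k + n)) (x (k + n)) - f (θ k) (x (k + n))‖ :=
          (norm_add_le _ _).trans_eq (by rw [norm_smul, Real.norm_of_nonneg hε])
      _ ≤ ((1 + ε * L) ^ n - 1 - n * (ε * L)) * (‖θ k‖ + 1) +
            ε * (L * (((1 + ε * L) ^ n - 1) * (‖θ k‖ + 1))) := by
          gcongr
          exact (hlip _ _ _).trans
            (mul_le_mul_of_nonneg_left (norm_iterate_sub_le hL hε hbnd hiter k n) hL)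
      _ = ((1 + ε * L) ^ (n + 1) - 1 - (n + 1 : ℕ) * (ε * L)) * (‖θ k‖ + 1) := by
          push_cast
          ring

end Iterates

/-- Bound on the auxiliary function
`g(k,T) = θ_{k+T} − θ_k − ε Σ_{j=k}^{k+T−1} f(θ_k, x_j)`. -/
theorem stmt_0
    (d : ℕ) (hd : 0 < d) (L ε : ℝ) (hL : 0 < L) (hε : 0 < ε)
    (𝒳 : Type*) [Nonempty 𝒳]
    (f : EuclideanSpace ℝ (Fin d) → 𝒳 → EuclideanSpace ℝ (Fin d))
    (hlip : ∀ θ θ' x, ‖f θ x - f θ' x‖ ≤ L * ‖θ - θ'‖)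
    (hbnd : ∀ θ x, ‖f θ x‖ ≤ L * (‖θ‖ + 1))
    (x : ℕ → 𝒳) (θ : ℕ → EuclideanSpace ℝ (Fin d))
    (hiter : ∀ j, θ (j + 1) = θ j + ε • f (θ j) (x j)) :
    ∀ k T : ℕ, 1 ≤ T →
      ‖θ (k + T) - θ k - ε • ∑ j ∈ Finset.Ico k (k + T), f (θ k) (x j)‖ ≤
        ε ^ 2 * L ^ 2 * (T : ℝ) ^ 2 * (1 + ε * L) ^ ((T : ℝ) - 2) * (‖θ k‖ + 1) := by
  intro k T hT
  refine (norm_iterate_sub_frozen_le hL.le hε.le hlip hbnd hiter k T).trans ?_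
  have ha : 0 ≤ ε * L := by positivity
  gcongr
  obtain rfl | ⟨n, rfl⟩ : T = 1 ∨ ∃ n, T = n + 2 :=
    (eq_or_lt_of_le hT).imp Eq.symm fun h => ⟨T - 2, by omega⟩
  · have h : (1 + ε * L) ^ 1 - 1 - ((1 : ℕ) : ℝ) * (ε * L) = 0 := by
      push_cast
      ring
    rw [h]
    positivity
  · have h := one_add_pow_sub_linear_le ha n
    push_cast
    rw [add_sub_cancel_right, Real.rpow_natCast, ← mul_pow]
    exact h
end

section
/- (Proposition 1) Define g'(k,T) := Θ_{k+T} − Θ_k − εT f̄(Θ_k) and β_k(T,ε) := εLT(1+εL)^{T−2} + σ(T,k). Then for every k ∈ ℕ and every T ∈ ℕ⁺, almost surely ‖E[g'(k,T) | 𝓕_k]‖ ≤ εLT β_k(T,ε) (‖Θ_k‖ + 1). -/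
open MeasureTheory Finset

section Recursion

variable {E 𝒳 : Type*} [NormedAddCommGroup E] [NormedSpace ℝ E] {L ε : ℝ}
  {f : E → 𝒳 → E} {θ : ℕ → E} {x : ℕ → 𝒳}

/-- Growth of the increments of a recursion driven by a map of linear growth. -/
theorem norm_recursion_sub_le (hL : 0 ≤ L) (hε : 0 ≤ ε)
    (hbnd : ∀ θ x, ‖f θ x‖ ≤ L * (‖θ‖ + 1))
    (hθ : ∀ n, θ (n + 1) = θ n + ε • f (θ n) (x n)) (k n : ℕ) :
    ‖θ (k + n) - θ k‖ ≤ ((1 + ε * L) ^ n - 1) * (‖θ k‖ + 1) := by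
  induction n with
  | zero => simp
  | succ n ih =>
    have h₁ : ‖θ (k + n)‖ ≤ ‖θ (k + n) - θ k‖ + ‖θ k‖ := by
      simpa using norm_add_le (θ (k + n) - θ k) (θ k)
    have h₂ : ‖ε • f (θ (k + n)) (x (k + n))‖ ≤ ε * L * (‖θ (k + n)‖ + 1) := by
      rw [norm_smul, Real.norm_of_nonneg hε, mul_assoc]
      exact mul_le_mul_of_nonneg_left (hbnd _ _) hε
    have ha : 0 ≤ ε * L := mul_nonneg hε hL
    calc ‖θ (k + (n + 1)) - θ k‖
        = ‖(θ (k + n) - θ k) + ε • f (θ (k + n)) (x (k + n))‖ := by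
          rw [← add_assoc, hθ]; congr 1; abel
      _ ≤ ‖θ (k + n) - θ k‖ + ε * L * (‖θ (k + n) - θ k‖ + ‖θ k‖ + 1) := by
          refine (norm_add_le _ _).trans (add_le_add le_rfl (h₂.trans ?_))
          gcongr
      _ = (1 + ε * L) * ‖θ (k + n) - θ k‖ + ε * L * (‖θ k‖ + 1) := by ring
      _ ≤ (1 + ε * L) * (((1 + ε * L) ^ n - 1) * (‖θ k‖ + 1)) + ε * L * (‖θ k‖ + 1) := by
          gcongr
      _ = ((1 + ε * L) ^ (n + 1) - 1) * (‖θ k‖ + 1) := by ring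

/-- Error made by freezing the parameter of a Lipschitz recursion at its value at time `k`. -/
theorem norm_recursion_sub_frozen_le (hL : 0 ≤ L) (hε : 0 ≤ ε)
    (hlip : ∀ θ θ' x, ‖f θ x - f θ' x‖ ≤ L * ‖θ - θ'‖)
    (hbnd : ∀ θ x, ‖f θ x‖ ≤ L * (‖θ‖ + 1))
    (hθ : ∀ n, θ (n + 1) = θ n + ε • f (θ n) (x n)) (k n : ℕ) :
    ‖θ (k + n) - θ k - ε • ∑ j ∈ Ico k (k + n), f (θ k) (x j)‖
      ≤ ((1 + ε * L) ^ n - 1 - ε * L * n) * (‖θ k‖ + 1) := by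
  induction n with
  | zero => simp
  | succ n ih =>
    have h₂ : ‖ε • (f (θ (k + n)) (x (k + n)) - f (θ k) (x (k + n)))‖
        ≤ ε * L * (((1 + ε * L) ^ n - 1) * (‖θ k‖ + 1)) := by
      rw [norm_smul, Real.norm_of_nonneg hε, mul_assoc]
      gcongr
      exact (hlip _ _ _).trans
        (mul_le_mul_of_nonneg_left (norm_recursion_sub_le hL hε hbnd hθ k n) hL)
    calc ‖θ (k + (n + 1)) - θ k - ε • ∑ j ∈ Ico k (k + (n + 1)), f (θ k) (x j)‖
        = ‖(θ (k + n) - θ k - ε • ∑ j ∈ Ico k (k + n), f (θ k) (x j))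
            + ε • (f (θ (k + n)) (x (k + n)) - f (θ k) (x (k + n)))‖ := by
          rw [← add_assoc, hθ, sum_Ico_succ_top (Nat.le_add_right k n), smul_add, smul_sub]
          congr 1; abel
      _ ≤ _ := (norm_add_le _ _).trans (add_le_add ih h₂)
      _ = _ := by push_cast; ring

end Recursion

/-- Second-order remainder bound for `(1 + a) ^ n`. -/
theorem one_add_pow_sub_le {a : ℝ} (ha : 0 ≤ a) (n : ℕ) :
    (1 + a) ^ (n + 2) - 1 - a * (n + 2) ≤ a ^ 2 * (n + 2) ^ 2 * (1 + a) ^ n := by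
  induction n with
  | zero => norm_num; nlinarith [sq_nonneg a]
  | succ n ih =>
    have h₁ : 1 ≤ (1 + a) ^ (n + 1) := one_le_pow₀ (by linarith)
    have h₂ := mul_le_mul_of_nonneg_left ih (by linarith : 0 ≤ 1 + a)
    have h₃ : a ^ 2 * (n + 2) ≤ a ^ 2 * (2 * n + 5) * (1 + a) ^ (n + 1) := by
      refine le_trans ?_ (le_mul_of_one_le_right (by positivity) h₁)
      gcongr <;> linarith [(Nat.cast_nonneg n : (0 : ℝ) ≤ n)]
    push_cast
    calc (1 + a) ^ (n + 1 + 2) - 1 - a * (n + 1 + 2)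
        = (1 + a) * ((1 + a) ^ (n + 2) - 1 - a * (n + 2)) + a ^ 2 * (n + 2) := by ring
      _ ≤ (1 + a) * (a ^ 2 * (n + 2) ^ 2 * (1 + a) ^ n)
            + a ^ 2 * (2 * n + 5) * (1 + a) ^ (n + 1) := add_le_add h₂ h₃
      _ = a ^ 2 * (n + 1 + 2) ^ 2 * (1 + a) ^ (n + 1) := by ring

theorem one_add_pow_sub_le_rpow {a : ℝ} (ha : 0 ≤ a) {T : ℕ} (hT : 1 ≤ T) :
    (1 + a) ^ T - 1 - a * T ≤ a * T * (a * T * (1 + a) ^ ((T : ℝ) - 2)) := by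
  obtain rfl | ⟨n, rfl⟩ : T = 1 ∨ ∃ n, T = n + 2 := by
    rcases T with _ | _ | n
    · omega
    · exact .inl rfl
    · exact .inr ⟨n, rfl⟩
  · have : 0 ≤ a * (a * (1 + a) ^ ((1 : ℝ) - 2)) := by positivity
    simpa using this
  · have h := one_add_pow_sub_le ha n
    have he : ((n + 2 : ℕ) : ℝ) - 2 = n := by push_cast; ring
    rw [he, Real.rpow_natCast]
    push_cast
    linarith

/-- **Proposition 1.** With `g'(k,T) := Θ_{k+T} − Θ_k − εT f̄(Θ_k)` and
`β_k(T,ε) := εLT(1+εL)^{T−2} + σ(T,k)`, for every `k ∈ ℕ` and `T ≥ 1`, almost surely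
`‖E[g'(k,T) | 𝓕_k]‖ ≤ εLT β_k(T,ε) (‖Θ_k‖ + 1)`. -/
theorem stmt_3
    {Ω : Type*} {m0 : MeasurableSpace Ω} (ℙ : Measure Ω) [IsProbabilityMeasure ℙ]
    {𝒳 : Type*} [m𝒳 : MeasurableSpace 𝒳]
    (X : ℕ → Ω → 𝒳) (hX : ∀ i, Measurable (X i))
    (F : ℕ → MeasurableSpace Ω)
    (hF : ∀ k, F k = ⨆ i ∈ Finset.range k, MeasurableSpace.comap (X i) m𝒳)
    (d : ℕ) (hd : 0 < d) (L ε : ℝ) (hL : 0 < L) (hε : 0 < ε)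
    (f : EuclideanSpace ℝ (Fin d) → 𝒳 → EuclideanSpace ℝ (Fin d))
    (hfmeas : Measurable fun p : EuclideanSpace ℝ (Fin d) × 𝒳 => f p.1 p.2)
    (hlip : ∀ θ θ' x, ‖f θ x - f θ' x‖ ≤ L * ‖θ - θ'‖)
    (hbnd : ∀ θ x, ‖f θ x‖ ≤ L * (‖θ‖ + 1))
    (fbar : EuclideanSpace ℝ (Fin d) → EuclideanSpace ℝ (Fin d))
    (hfbarLip : ∀ θ θ', ‖fbar θ - fbar θ'‖ ≤ L * ‖θ - θ'‖) (hfbar0 : fbar 0 = 0)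
    (Θ₀ : EuclideanSpace ℝ (Fin d)) (Θ : ℕ → Ω → EuclideanSpace ℝ (Fin d))
    (hΘ0 : Θ 0 = fun _ => Θ₀)
    (hΘ : ∀ k, Θ (k + 1) = fun ω => Θ k ω + ε • f (Θ k ω) (X k ω))
    (σ : ℕ → ℕ → ℝ) (hσ : ∀ T k, 0 ≤ σ T k)
    (hergo : ∀ k T : ℕ, 1 ≤ T → ∀ᵐ ω ∂ℙ,
      ‖(1 / (T : ℝ)) • ∑ j ∈ Finset.Ico k (k + T),
          (ℙ[fun ω' => f (Θ k ω') (X j ω') | F k]) ω - fbar (Θ k ω)‖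
        ≤ σ T k * L * (‖Θ k ω‖ + 1)) :
    ∀ k T : ℕ, 1 ≤ T → ∀ᵐ ω ∂ℙ,
      ‖(ℙ[fun ω' => Θ (k + T) ω' - Θ k ω' - (ε * T) • fbar (Θ k ω') | F k]) ω‖
        ≤ ε * L * T * (ε * L * T * (1 + ε * L) ^ ((T : ℝ) - 2) + σ T k)
            * (‖Θ k ω‖ + 1) := by
  intro k T hT
  have hXF : ∀ i k, i < k → Measurable[F k] (X i) := fun i k hik => by
    rw [measurable_iff_comap_le, hF]
    exact le_iSup₂_of_le i (mem_range.2 hik) le_rfl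
  have hFle : ∀ k, F k ≤ m0 := fun k => by
    rw [hF]
    exact iSup₂_le fun i _ => (hX i).comap_le
  have hFmono : ∀ k, F k ≤ F (k + 1) := fun k => by
    rw [hF k]
    exact iSup₂_le fun i hi => (hXF i (k + 1) (by have := mem_range.1 hi; omega)).comap_le
  have hΘmeas : ∀ k, Measurable[F k] (Θ k) := by
    intro k
    induction k with
    | zero => rw [hΘ0]; exact measurable_const
    | succ k ih =>
      rw [hΘ]
      have h₁ : Measurable[F (k + 1)] (Θ k) := ih.mono (hFmono k) le_rfl
      have h₂ : Measurable[F (k + 1)] fun ω => f (Θ k ω) (X k ω) :=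
        hfmeas.comp (h₁.prodMk (hXF k (k + 1) k.lt_succ_self))
      exact h₁.add (h₂.const_smul ε)
  have hrec : ∀ ω n, Θ (n + 1) ω = Θ n ω + ε • f (Θ n ω) (X n ω) := fun ω n => by rw [hΘ]
  have hΘint : ∀ k, Integrable (Θ k) ℙ := fun k => by
    refine Integrable.of_bound ((hΘmeas k).mono (hFle k) le_rfl).aestronglyMeasurable
      (((1 + ε * L) ^ k - 1) * (‖Θ₀‖ + 1) + ‖Θ₀‖) (ae_of_all _ fun ω => ?_)
    have h := norm_recursion_sub_le (θ := fun n => Θ n ω) (x := fun n => X n ω)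
      hL.le hε.le hbnd (hrec ω) 0 k
    simp only [zero_add, hΘ0] at h
    have h' := norm_add_le (Θ k ω - Θ₀) Θ₀
    rw [sub_add_cancel] at h'
    linarith
  have hNint : Integrable (fun ω => ‖Θ k ω‖ + 1) ℙ := (hΘint k).norm.add (integrable_const 1)
  have hfint : ∀ j, Integrable (fun ω => f (Θ k ω) (X j ω)) ℙ := fun j =>
    (hNint.const_mul L).mono'
      (hfmeas.comp (((hΘmeas k).mono (hFle k) le_rfl).prodMk (hX j))).aestronglyMeasurable
      (ae_of_all _ fun ω => hbnd _ _)
  have hfbarcont : Continuous fbar :=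
    (LipschitzWith.of_dist_le_mul (K := L.toNNReal) fun θ θ' => by
      simpa [dist_eq_norm, hL.le] using hfbarLip θ θ').continuous
  have hbarmeas : StronglyMeasurable[F k] fun ω => fbar (Θ k ω) :=
    (hfbarcont.measurable.comp (hΘmeas k)).stronglyMeasurable
  have hbarint : Integrable (fun ω => fbar (Θ k ω)) ℙ :=
    (hNint.const_mul L).mono' (hbarmeas.mono (hFle k)).aestronglyMeasurable
      (ae_of_all _ fun ω => by
        have h := hfbarLip (Θ k ω) 0
        rw [hfbar0, sub_zero, sub_zero] at h
        linarith)
  set S : Ω → EuclideanSpace ℝ (Fin d) :=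
    ∑ j ∈ Ico k (k + T), fun ω => f (Θ k ω) (X j ω) with hS
  set R : Ω → EuclideanSpace ℝ (Fin d) := Θ (k + T) - Θ k - ε • S with hR
  set B : Ω → EuclideanSpace ℝ (Fin d) := fun ω => fbar (Θ k ω) with hB
  have hSint : Integrable S ℙ := integrable_finsetSum' _ fun j _ => hfint j
  have hRint : Integrable R ℙ := ((hΘint _).sub (hΘint _)).sub (hSint.smul ε)
  have hdecomp : (fun ω' => Θ (k + T) ω' - Θ k ω' - (ε * T) • fbar (Θ k ω'))
      = R + (ε • S - (ε * T) • B) := by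
    funext ω
    simp only [hR, hB, Pi.add_apply, Pi.sub_apply, Pi.smul_apply]
    abel
  set c : ℝ := (1 + ε * L) ^ T - 1 - ε * L * T with hc
  have hRbound : ∀ ω, ‖R ω‖ ≤ c * (‖Θ k ω‖ + 1) := fun ω => by
    have h := norm_recursion_sub_frozen_le (θ := fun n => Θ n ω) (x := fun n => X n ω)
      hL.le hε.le hlip hbnd (hrec ω) k T
    simpa [hR, hS] using h
  have hcN : ℙ[fun ω => c * (‖Θ k ω‖ + 1) | F k] = fun ω => c * (‖Θ k ω‖ + 1) :=
    condExp_of_stronglyMeasurable (hFle k)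
      ((Continuous.measurable (by fun_prop :
        Continuous fun θ : EuclideanSpace ℝ (Fin d) => c * (‖θ‖ + 1))).comp
          (hΘmeas k)).stronglyMeasurable (hNint.const_mul c)
  have hBc : ℙ[B | F k] = B := condExp_of_stronglyMeasurable (hFle k) hbarmeas hbarint
  rw [hdecomp]
  filter_upwards [condExp_add hRint ((hSint.smul ε).sub (hbarint.smul (ε * (T : ℝ)))) (F k),
    condExp_sub (hSint.smul ε) (hbarint.smul (ε * (T : ℝ))) (F k),
    condExp_smul (μ := ℙ) ε S (F k), condExp_smul (μ := ℙ) (ε * (T : ℝ)) B (F k),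
    condExp_finsetSum (μ := ℙ) (s := Ico k (k + T)) (fun j _ => hfint j) (F k),
    norm_condExp_le (μ := ℙ) (m := F k) R,
    condExp_mono (m := F k) hRint.norm (hNint.const_mul c) (ae_of_all _ hRbound),
    hergo k T hT] with ω h₁ h₂ h₃ h₄ h₅ h₆ h₇ h₈
  rw [hcN] at h₇
  have hT0 : (0 : ℝ) < T := by exact_mod_cast hT
  have hmain : ‖ε • (ℙ[S | F k]) ω - (ε * (T : ℝ)) • B ω‖
      ≤ ε * T * (σ T k * L * (‖Θ k ω‖ + 1)) := by
    rw [Finset.sum_apply] at h₅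
    rw [← h₅] at h₈
    have : ε • (ℙ[S | F k]) ω - (ε * (T : ℝ)) • B ω
        = (ε * (T : ℝ)) • ((1 / (T : ℝ)) • (ℙ[S | F k]) ω - fbar (Θ k ω)) := by
      rw [smul_sub, smul_smul]
      congr 2
      field_simp
    rw [this, norm_smul, Real.norm_of_nonneg (by positivity)]
    gcongr
  rw [h₁, Pi.add_apply, h₂, Pi.sub_apply, h₃, h₄, Pi.smul_apply, Pi.smul_apply, hBc]
  have hcle := one_add_pow_sub_le_rpow (mul_pos hε hL).le hT
  calc _ ≤ ‖(ℙ[R | F k]) ω‖ + ‖ε • (ℙ[S | F k]) ω - (ε * (T : ℝ)) • B ω‖ := norm_add_le _ _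
    _ ≤ c * (‖Θ k ω‖ + 1) + ε * T * (σ T k * L * (‖Θ k ω‖ + 1)) :=
      add_le_add (h₆.trans h₇) hmain
    _ ≤ ε * L * T * (ε * L * T * (1 + ε * L) ^ ((T : ℝ) - 2)) * (‖Θ k ω‖ + 1)
          + ε * T * (σ T k * L * (‖Θ k ω‖ + 1)) := by gcongr
    _ = _ := by ring
end

section
/- Suppose the base chain p is primitive: there exists N ∈ ℕ such that for all n ≥ N and all s, s'' ∈ S, the (s,s'') entry of the n-th matrix power p^n is strictly positive (equivalently, the base chain is irreducible and aperiodic). Then the triple chain q is primitive on 𝒳: there exists M ∈ ℕ such that for all n ≥ M and all x, x' ∈ 𝒳, the (x,x') entry of q^n is strictly positive. Moreover, for all x_i = (s_i,u_i,s_i') and x_j = (s_j,u_j,s_j') in 𝒳 and all n ∈ ℕ, the (x_i,x_j) entry of q^{n+1} equals (p^n)(s_i', s_j) · π(u_j | s_j) · P^{u_j}(s_j, s_j'). -/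
open Finset

/-- If the base chain `p(s,s') = Σ_u π(u|s) P^u(s,s')` is primitive,
then the triple chain `q((s,u,s'),(t,v,t')) = [t = s'] π(v|t) P^v(t,t')` is primitive on
`𝒳 = {(s,u,s') : π(u|s) > 0, P^u(s,s') > 0}`; moreover, for all `x_i, x_j ∈ 𝒳` and `n`,
`(q^{n+1})(x_i,x_j) = (p^n)(s_i',s_j) · π(u_j|s_j) · P^{u_j}(s_j,s_j')`. -/
theorem stmt_18
    (S U : Type*) [Fintype S] [Nonempty S] [DecidableEq S]
    [Fintype U] [Nonempty U] [DecidableEq U]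
    (π : S → U → ℝ) (hπ0 : ∀ s u, 0 ≤ π s u) (hπ1 : ∀ s, ∑ u, π s u = 1)
    (P : U → Matrix S S ℝ) (hP0 : ∀ u s s', 0 ≤ P u s s')
    (hP1 : ∀ u s, ∑ s', P u s s' = 1)
    (p : Matrix S S ℝ) (hp : p = Matrix.of fun s s' => ∑ u, π s u * P u s s')
    (q : Matrix (S × U × S) (S × U × S) ℝ)
    (hq : q = Matrix.of fun x y : S × U × S =>
      (if y.1 = x.2.2 then (1 : ℝ) else 0) * π y.1 y.2.1 * P y.2.1 y.1 y.2.2)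
    (hprim : ∃ N : ℕ, ∀ n ≥ N, ∀ s s'' : S, 0 < (p ^ n) s s'') :
    (∃ M : ℕ, ∀ n ≥ M, ∀ x x' : S × U × S,
        0 < π x.1 x.2.1 → 0 < P x.2.1 x.1 x.2.2 →
        0 < π x'.1 x'.2.1 → 0 < P x'.2.1 x'.1 x'.2.2 →
        0 < (q ^ n) x x') ∧
    ∀ x y : S × U × S,
      0 < π x.1 x.2.1 → 0 < P x.2.1 x.1 x.2.2 →
      0 < π y.1 y.2.1 → 0 < P y.2.1 y.1 y.2.2 →
      ∀ n : ℕ,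
        (q ^ (n + 1)) x y = (p ^ n) x.2.2 y.1 * π y.1 y.2.1 * P y.2.1 y.1 y.2.2 := by
  have key : ∀ (n : ℕ) (x y : S × U × S),
      (q ^ (n + 1)) x y = (p ^ n) x.2.2 y.1 * π y.1 y.2.1 * P y.2.1 y.1 y.2.2 := by
    intro n
    induction n with
    | zero =>
      intro x y
      simp [hq, Matrix.one_apply, eq_comm]
    | succ n ih =>
      intro x y
      rw [pow_succ, Matrix.mul_apply, pow_succ p, Matrix.mul_apply]
      simp only [ih]
      simp only [hq, hp, Matrix.of_apply, Fintype.sum_prod_type, Finset.mul_sum, Finset.sum_mul]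
      refine Finset.sum_congr rfl fun s _ => Finset.sum_congr rfl fun u _ => ?_
      rw [Finset.sum_eq_single y.1]
      · simp only [if_true]
        ring
      · intro t _ ht
        simp [Ne.symm ht]
      · simp
  refine ⟨?_, fun x y _ _ _ _ n => key n x y⟩
  obtain ⟨N, hN⟩ := hprim
  refine ⟨N + 1, fun n hn x y _ _ hy hy' => ?_⟩
  obtain ⟨m, rfl⟩ : ∃ m, n = m + 1 := ⟨n - 1, by omega⟩
  rw [key]
  exact mul_pos (mul_pos (hN m (by omega) _ _) hy) hy'
end
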